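/- (LP value comparison under confidence bounds) Let 𝒮 denote the collection of all subsets of {1,…,N} (including ∅). Let R*, R̂ : 𝒮 → ℝ and, for each k ∈ {1,…,K}, A*_k, Â_k : 𝒮 → ℝ satisfy: R̂(S) ≥ R*(S) and Â_k(S) ≤ A*_k(S) for all S and k, with R̂(∅) = R*(∅) = Â_k(∅) = A*_k(∅) = 0 and Â_k(S) ≥ 0 for all S, k. Let c_1,…,c_K ≥ 0 and ω ∈ [0,1]. If y* : 𝒮 → ℝ_{≥0} satisfies ∑_{S} y*(S) = 1 and ∑_{S} A*_k(S) y*(S) ≤ c_k for all k, then the vector ȳ defined by ȳ(S) = (1−ω) y*(S) for S ≠ ∅ and ȳ(∅) = (1−ω) y*(∅) + ω satisfies ȳ ≥ 0, ∑_S ȳ(S) = 1, ∑_S Â_k(S) ȳ(S) ≤ (1−ω) c_k for all k, and ∑_S R̂(S) ȳ(S) ≥ (1−ω) ∑_S R*(S) y*(S). Consequently, the optimal value of the LP max{ ∑_S R̂(S) y(S) : y ≥ 0, ∑_S y(S) = 1, ∑_S Â_k(S) y(S) ≤ (1−ω)c_k ∀k } is at least (1−ω) times the optimal value of max{ ∑_S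 R*(S) y(S) : y ≥ 0, ∑_S y(S) = 1, ∑_S A*_k(S) y(S) ≤ c_k ∀k }. -/

import Mathlib

theorem lp_key (N K : ℕ)
    (Rstar Rhat : Finset (Fin N) → ℝ)
    (Astar Ahat : Fin K → Finset (Fin N) → ℝ)
    (hR : ∀ S, Rstar S ≤ Rhat S)
    (hA : ∀ k S, Ahat k S ≤ Astar k S)
    (hR0 : Rhat ∅ = 0)
    (hA0 : ∀ k, Ahat k ∅ = 0)
    (c : Fin K → ℝ)
    (ω : ℝ) (h0 : 0 ≤ ω) (h1 : 0 ≤ 1 - ω)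
    (y : Finset (Fin N) → ℝ)
    (hynn : ∀ S, 0 ≤ y S)
    (hysum : ∑ S : Finset (Fin N), y S = 1)
    (hyfeas : ∀ k, ∑ S : Finset (Fin N), Astar k S * y S ≤ c k)
    (ybar : Finset (Fin N) → ℝ)
    (hybar : ybar = fun S =>
      if S = ∅ then (1 - ω) * y S + ω else (1 - ω) * y S) :
    (∀ S, 0 ≤ ybar S) ∧
    (∑ S : Finset (Fin N), ybar S = 1) ∧
    (∀ k, ∑ S : Finset (Fin N), Ahat k S * ybar S ≤ (1 - ω) * c k) ∧
    ((1 - ω) * ∑ S : Finset (Fin N), Rstar S * y S ≤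
      ∑ S : Finset (Fin N), Rhat S * ybar S) := by
  have hb : ∀ S, ybar S = (1 - ω) * y S + if S = ∅ then ω else 0 := by
    intro S
    rw [hybar]
    by_cases h : S = ∅ <;> simp [h]
  have hf : ∀ f : Finset (Fin N) → ℝ, f ∅ = 0 →
      ∀ S, f S * ybar S = (1 - ω) * (f S * y S) := by
    intro f hf S
    rw [hb]
    by_cases h : S = ∅
    · subst h
      simp [hf]
    · simp only [h, if_false]
      ring
  refine ⟨?_, ?_, ?_, ?_⟩
  · intro S
    rw [hb]
    have := mul_nonneg h1 (hynn S)
    split_ifs <;> linarith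
  · simp only [hb, Finset.sum_add_distrib, ← Finset.mul_sum, hysum]
    simp
  · intro k
    simp only [hf (Ahat k) (hA0 k), ← Finset.mul_sum]
    refine mul_le_mul_of_nonneg_left (le_trans (Finset.sum_le_sum fun S _ => ?_) (hyfeas k)) h1
    exact mul_le_mul_of_nonneg_right (hA k S) (hynn S)
  · simp only [hf Rhat hR0, ← Finset.mul_sum]
    refine mul_le_mul_of_nonneg_left (Finset.sum_le_sum fun S _ => ?_) h1
    exact mul_le_mul_of_nonneg_right (hR S) (hynn S)

/-- LP value comparison under confidence bounds.  `𝒮` is the collection of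
all subsets of `{1,…,N}`, encoded as `Finset (Fin N)`.  Given optimistic estimates
`R̂ ≥ R*` and `Â_k ≤ A*_k` (vanishing on `∅`, with `Â_k ≥ 0`), capacities `c_k ≥ 0` and
`ω ∈ [0,1]`: for any feasible `y*` for the true LP, the shifted vector
`ȳ(S) = (1−ω) y*(S) + ω·𝟙[S = ∅]` is feasible for the tightened optimistic LP and loses
at most a factor `(1−ω)` in objective; consequently the optimal value of the optimistic
LP is at least `(1−ω)` times that of the true LP. -/
theorem lp_value_comparison (N K : ℕ)
    (Rstar Rhat : Finset (Fin N) → ℝ)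
    (Astar Ahat : Fin K → Finset (Fin N) → ℝ)
    (hR : ∀ S, Rstar S ≤ Rhat S)
    (hA : ∀ k S, Ahat k S ≤ Astar k S)
    (hR0 : Rhat ∅ = 0 ∧ Rstar ∅ = 0)
    (hA0 : ∀ k, Ahat k ∅ = 0 ∧ Astar k ∅ = 0)
    (hAnn : ∀ k S, 0 ≤ Ahat k S)
    (c : Fin K → ℝ) (hc : ∀ k, 0 ≤ c k)
    (ω : ℝ) (hω : ω ∈ Set.Icc (0 : ℝ) 1)
    (ystar : Finset (Fin N) → ℝ)
    (hynn : ∀ S, 0 ≤ ystar S)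
    (hysum : ∑ S : Finset (Fin N), ystar S = 1)
    (hyfeas : ∀ k, ∑ S : Finset (Fin N), Astar k S * ystar S ≤ c k)
    (ybar : Finset (Fin N) → ℝ)
    (hybar : ybar = fun S =>
      if S = ∅ then (1 - ω) * ystar S + ω else (1 - ω) * ystar S) :
    (∀ S, 0 ≤ ybar S) ∧
    (∑ S : Finset (Fin N), ybar S = 1) ∧
    (∀ k, ∑ S : Finset (Fin N), Ahat k S * ybar S ≤ (1 - ω) * c k) ∧
    ((1 - ω) * ∑ S : Finset (Fin N), Rstar S * ystar S ≤
      ∑ S : Finset (Fin N), Rhat S * ybar S) ∧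
    (1 - ω) * sSup {z : ℝ | ∃ y : Finset (Fin N) → ℝ,
        ((∀ S, 0 ≤ y S) ∧ (∑ S : Finset (Fin N), y S = 1) ∧
          ∀ k, ∑ S : Finset (Fin N), Astar k S * y S ≤ c k) ∧
        z = ∑ S : Finset (Fin N), Rstar S * y S} ≤
      sSup {z : ℝ | ∃ y : Finset (Fin N) → ℝ,
        ((∀ S, 0 ≤ y S) ∧ (∑ S : Finset (Fin N), y S = 1) ∧
          ∀ k, ∑ S : Finset (Fin N), Ahat k S * y S ≤ (1 - ω) * c k) ∧
        z = ∑ S : Finset (Fin N), Rhat S * y S} := by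
  have h1 : 0 ≤ 1 - ω := by linarith [hω.2]
  have key := lp_key N K Rstar Rhat Astar Ahat hR hA hR0.1 (fun k => (hA0 k).1) c ω hω.1 h1
  obtain ⟨a1, a2, a3, a4⟩ := key ystar hynn hysum hyfeas ybar hybar
  refine ⟨a1, a2, a3, a4, ?_⟩
  rw [← smul_eq_mul, ← Real.sSup_smul_of_nonneg h1]
  refine csSup_le (Set.Nonempty.smul_set ⟨_, ystar, ⟨hynn, hysum, hyfeas⟩, rfl⟩) ?_
  rintro _ ⟨_, ⟨y, ⟨b1, b2, b3⟩, rfl⟩, rfl⟩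
  obtain ⟨d1, d2, d3, d4⟩ := key y b1 b2 b3 _ rfl
  refine le_trans d4 (le_csSup ?_ ⟨_, ⟨d1, d2, d3⟩, rfl⟩)
  refine ⟨∑ S, |Rhat S|, ?_⟩
  rintro _ ⟨z, ⟨e1, e2, e3⟩, rfl⟩
  refine Finset.sum_le_sum fun S _ => ?_
  have hz : z S ≤ 1 := e2 ▸ Finset.single_le_sum (fun i _ => e1 i) (Finset.mem_univ S)
  calc Rhat S * z S ≤ |Rhat S| * z S := mul_le_mul_of_nonneg_right (le_abs_self _) (e1 S)
    _ ≤ |Rhat S| * 1 := mul_le_mul_of_nonneg_left hz (abs_nonneg _)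
    _ = |Rhat S| := mul_one _
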